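/- Let 1 < α ≤ 2. There exists C > 0, depending only on α, such that for every n ≥ 1 with h = 1/(n+1), every continuous g : [0,1] → ℝ with g(0) = 0, and every x ∈ [0,1]: |Π_n f(x) − f(x)| ≤ C h^α sup_{s∈[0,1]} |g(s)|, where f(x) := I^α g(x) − I^α g(1)·x^{α−1}. -/

import Mathlib

open MeasureTheory intervalIntegral

/-- Concavity of `(· - s) ^ β` with respect to the variable `x ^ β`, as a case of Minkowski's
inequality for the exponent `1 / β`. -/
lemma weighted_sub_rpow_le {β a b x s θ : ℝ} (hβ0 : 0 < β) (hβ1 : β ≤ 1) (hs : 0 ≤ s)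
    (hsa : s ≤ a) (hsb : s ≤ b) (hax : a ≤ x) (hθ0 : 0 ≤ θ) (hθ1 : θ ≤ 1)
    (hx : x ^ β = (1 - θ) * a ^ β + θ * b ^ β) :
    (1 - θ) * (a - s) ^ β + θ * (b - s) ^ β ≤ (x - s) ^ β := by
  have hp : 1 ≤ 1 / β := by rw [le_div_iff₀ hβ0]; linarith
  have h1θ : 0 ≤ 1 - θ := by linarith
  have hroot (y : ℝ) (hy : 0 ≤ y) : (y ^ β) ^ (1 / β) = y := by
    rw [← Real.rpow_mul hy, mul_one_div_cancel hβ0.ne', Real.rpow_one]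
  have hroot' (y : ℝ) (hy : 0 ≤ y) : (y ^ (1 / β)) ^ β = y := by
    rw [← Real.rpow_mul hy, one_div_mul_cancel hβ0.ne', Real.rpow_one]
  have hva : 0 ≤ (a - s) ^ β := Real.rpow_nonneg (by linarith) _
  have hvb : 0 ≤ (b - s) ^ β := Real.rpow_nonneg (by linarith) _
  have hS : 0 ≤ s ^ β := Real.rpow_nonneg hs _
  have hnorm (c y : ℝ) (hc : 0 ≤ c) (hy : s ≤ y) :
      ((c * (y - s) ^ β) ^ (1 / β) + (c * s ^ β) ^ (1 / β)) ^ β = c * y ^ β := by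
    rw [Real.mul_rpow hc (Real.rpow_nonneg (by linarith) _), Real.mul_rpow hc hS,
      hroot _ (by linarith), hroot _ hs, ← mul_add, sub_add_cancel,
      Real.mul_rpow (Real.rpow_nonneg hc _) (by linarith), hroot' c hc]
  have hmink := Real.Lp_add_le_of_nonneg (s := (Finset.univ : Finset (Fin 2)))
    (f := ![(1 - θ) * (a - s) ^ β, (1 - θ) * s ^ β])
    (g := ![θ * (b - s) ^ β, θ * s ^ β]) hp
    (by intro i _; fin_cases i <;> simp <;> positivity)
    (by intro i _; fin_cases i <;> simp <;> positivity)
  simp only [Fin.sum_univ_two, Matrix.cons_val_zero, Matrix.cons_val_one, one_div_one_div]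
    at hmink
  rw [hnorm _ a h1θ hsa, hnorm _ b hθ0 hsb, ← hx,
    show (1 - θ) * s ^ β + θ * s ^ β = s ^ β by ring, hroot s hs] at hmink
  set V := (1 - θ) * (a - s) ^ β + θ * (b - s) ^ β with hV
  have hV0 : 0 ≤ V := by positivity
  have hle : V ^ (1 / β) + s ≤ x :=
    (Real.rpow_le_rpow_iff (by positivity) (by linarith) hβ0).1 hmink
  calc V = (V ^ (1 / β)) ^ β := (hroot' V hV0).symm
    _ ≤ (x - s) ^ β := Real.rpow_le_rpow (by positivity) (by linarith) hβ0.le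

/-- Convexity of `x ^ (β + 1)` with respect to the variable `x ^ β`. -/
lemma rpow_add_one_le_weighted {β a b x θ : ℝ} (hβ0 : 0 < β) (ha : 0 ≤ a) (hb : 0 ≤ b)
    (hx0 : 0 ≤ x) (hθ0 : 0 ≤ θ) (hθ1 : θ ≤ 1)
    (hx : x ^ β = (1 - θ) * a ^ β + θ * b ^ β) :
    x ^ (β + 1) ≤ (1 - θ) * a ^ (β + 1) + θ * b ^ (β + 1) := by
  have hq : 1 ≤ (β + 1) / β := by rw [le_div_iff₀ hβ0]; linarith
  have hpow (y : ℝ) (hy : 0 ≤ y) : (y ^ β) ^ ((β + 1) / β) = y ^ (β + 1) := by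
    rw [← Real.rpow_mul hy, mul_div_cancel₀ _ hβ0.ne']
  have := (convexOn_rpow hq).2 (Set.mem_Ici.2 (Real.rpow_nonneg ha β))
    (Set.mem_Ici.2 (Real.rpow_nonneg hb β)) (sub_nonneg.2 hθ1) hθ0 (by ring)
  simpa only [smul_eq_mul, ← hx, hpow _ ha, hpow _ hb, hpow _ hx0] using this

lemma integral_sub_rpow {β a y : ℝ} (hβ0 : 0 < β) :
    ∫ s in (0 : ℝ)..a, (y - s) ^ β = (y ^ (β + 1) - (y - a) ^ (β + 1)) / (β + 1) := by
  rw [intervalIntegral.integral_comp_sub_left (fun s => s ^ β) y,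
    integral_rpow (Or.inl (by linarith)), sub_zero]

lemma intervalIntegrable_sub_rpow_mul {β y c d : ℝ} {g : ℝ → ℝ} (hβ0 : 0 < β)
    (hg : ContinuousOn g (Set.Icc 0 1)) (hc : 0 ≤ c) (hcd : c ≤ d) (hd : d ≤ 1) :
    IntervalIntegrable (fun s => (y - s) ^ β * g s) volume c d := by
  apply ContinuousOn.intervalIntegrable
  rw [Set.uIcc_of_le hcd]
  exact ((continuous_const.sub continuous_id).rpow_const fun _ => Or.inr hβ0.le).continuousOn.mul
    (hg.mono (Set.Icc_subset_Icc hc hd))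

lemma abs_integral_sub_rpow_mul_le {β a b y G : ℝ} {g : ℝ → ℝ} (hβ0 : 0 < β) (ha : 0 ≤ a)
    (hb : b ≤ 1) (hay : a ≤ y) (hyb : y ≤ b) (hG : ∀ s ∈ Set.Icc (0 : ℝ) 1, |g s| ≤ G) :
    |∫ s in a..y, (y - s) ^ β * g s| ≤ (b - a) ^ (β + 1) * G := by
  have hG0 : 0 ≤ G := (abs_nonneg _).trans (hG a ⟨ha, by linarith⟩)
  have hpt : ∀ s ∈ Set.uIoc a y, ‖(y - s) ^ β * g s‖ ≤ (b - a) ^ β * G := by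
    intro s hs
    rw [Set.uIoc_of_le hay] at hs
    have h0 : 0 ≤ y - s := by linarith [hs.2]
    rw [norm_mul, Real.norm_eq_abs, Real.norm_eq_abs, abs_of_nonneg (Real.rpow_nonneg h0 _)]
    exact mul_le_mul (Real.rpow_le_rpow h0 (by linarith [hs.1]) hβ0.le)
      (hG s ⟨by linarith [hs.1], by linarith [hs.2]⟩) (abs_nonneg _)
      (Real.rpow_nonneg (by linarith) _)
  calc |∫ s in a..y, (y - s) ^ β * g s| ≤ (b - a) ^ β * G * |y - a| :=
        intervalIntegral.norm_integral_le_of_norm_le_const hpt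
    _ ≤ (b - a) ^ β * G * (b - a) := by
        rw [abs_of_nonneg (by linarith)]
        have : 0 ≤ (b - a) ^ β := Real.rpow_nonneg (by linarith) _
        gcongr
    _ = (b - a) ^ (β + 1) * G := by
        rw [Real.rpow_add_one' (by linarith) (by linarith)]; ring

/-- The part of the interpolation error contributed by the values of `g` to the left of the
interpolation interval `[a, b]`. -/
lemma abs_integral_weighted_le {β a b x θ G : ℝ} {g : ℝ → ℝ} (hβ0 : 0 < β) (hβ1 : β ≤ 1)
    (ha : 0 ≤ a) (hax : a ≤ x) (hxb : x ≤ b) (hb : b ≤ 1) (hθ0 : 0 ≤ θ) (hθ1 : θ ≤ 1)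
    (hx : x ^ β = (1 - θ) * a ^ β + θ * b ^ β)
    (hG : ∀ s ∈ Set.Icc (0 : ℝ) 1, |g s| ≤ G) :
    |∫ s in (0 : ℝ)..a, ((1 - θ) * (a - s) ^ β + θ * (b - s) ^ β - (x - s) ^ β) * g s| ≤
      (b - a) ^ (β + 1) * G := by
  have hG0 : 0 ≤ G := (abs_nonneg _).trans (hG a ⟨ha, by linarith⟩)
  have hcont (y : ℝ) : Continuous fun s : ℝ => (y - s) ^ β :=
    (continuous_const.sub continuous_id).rpow_const fun _ => Or.inr hβ0.le
  have hint (y : ℝ) : IntervalIntegrable (fun s : ℝ => (y - s) ^ β) volume 0 a :=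
    (hcont y).intervalIntegrable _ _
  have hbound : |∫ s in (0 : ℝ)..a,
      ((1 - θ) * (a - s) ^ β + θ * (b - s) ^ β - (x - s) ^ β) * g s| ≤
      ∫ s in (0 : ℝ)..a, ((x - s) ^ β - ((1 - θ) * (a - s) ^ β + θ * (b - s) ^ β)) * G := by
    rw [← Real.norm_eq_abs]
    refine intervalIntegral.norm_integral_le_of_norm_le ha (Filter.Eventually.of_forall ?_)
      (Continuous.intervalIntegrable (((hcont x).sub
        (((hcont a).const_mul _).add ((hcont b).const_mul _))).mul_const G) _ _)
    intro s hs
    have hk := weighted_sub_rpow_le hβ0 hβ1 hs.1.le hs.2 (by linarith [hs.2]) hax hθ0 hθ1 hx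
    rw [norm_mul, Real.norm_eq_abs, Real.norm_eq_abs, abs_of_nonpos (by linarith), neg_sub]
    exact mul_le_mul_of_nonneg_left (hG s ⟨hs.1.le, by linarith [hs.2]⟩) (by linarith)
  refine hbound.trans ?_
  rw [intervalIntegral.integral_mul_const,
    intervalIntegral.integral_sub (hint x) (((hint a).const_mul _).add ((hint b).const_mul _)),
    intervalIntegral.integral_add ((hint a).const_mul _) ((hint b).const_mul _),
    intervalIntegral.integral_const_mul, intervalIntegral.integral_const_mul,
    integral_sub_rpow hβ0, integral_sub_rpow hβ0, integral_sub_rpow hβ0, sub_self,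
    Real.zero_rpow (by linarith)]
  refine mul_le_mul_of_nonneg_right ?_ hG0
  have hconv := rpow_add_one_le_weighted hβ0 ha (by linarith) (by linarith) hθ0 hθ1 hx
  have h1 : 0 ≤ (x - a) ^ (β + 1) := Real.rpow_nonneg (by linarith) _
  have h2 : 0 ≤ (b - a) ^ (β + 1) := Real.rpow_nonneg (by linarith) _
  have h3 : θ * (b - a) ^ (β + 1) ≤ (b - a) ^ (β + 1) := mul_le_of_le_one_left h2 hθ1
  have h4 : 0 ≤ (b - a) ^ (β + 1) * β := by positivity
  rw [← sub_nonneg]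
  have : (b - a) ^ (β + 1) - ((x ^ (β + 1) - (x - a) ^ (β + 1)) / (β + 1) -
      ((1 - θ) * ((a ^ (β + 1) - 0) / (β + 1)) +
        θ * ((b ^ (β + 1) - (b - a) ^ (β + 1)) / (β + 1)))) =
      ((b - a) ^ (β + 1) * (β + 1) - (x ^ (β + 1) - (x - a) ^ (β + 1) -
      ((1 - θ) * a ^ (β + 1) + θ * (b ^ (β + 1) - (b - a) ^ (β + 1))))) / (β + 1) := by
    field_simp
    ring
  rw [this]
  apply div_nonneg _ (by linarith)
  linarith

/-- The error, on a single interval `[a, b]`, of interpolating an unnormalised fractional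
integral by a combination of `1` and `x ^ β`. -/
lemma abs_weighted_fractional_integral_sub_le {β a b x θ G : ℝ} {g : ℝ → ℝ} (hβ0 : 0 < β)
    (hβ1 : β ≤ 1) (ha : 0 ≤ a) (hax : a ≤ x) (hxb : x ≤ b) (hb : b ≤ 1) (hθ0 : 0 ≤ θ)
    (hθ1 : θ ≤ 1) (hx : x ^ β = (1 - θ) * a ^ β + θ * b ^ β)
    (hg : ContinuousOn g (Set.Icc 0 1)) (hG : ∀ s ∈ Set.Icc (0 : ℝ) 1, |g s| ≤ G) :
    |(1 - θ) * (∫ s in (0 : ℝ)..a, (a - s) ^ β * g s) +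
      θ * (∫ s in (0 : ℝ)..b, (b - s) ^ β * g s) - ∫ s in (0 : ℝ)..x, (x - s) ^ β * g s| ≤
      3 * ((b - a) ^ (β + 1) * G) := by
  have hsplit (y : ℝ) (hay : a ≤ y) (hy : y ≤ 1) : ∫ s in (0 : ℝ)..y, (y - s) ^ β * g s =
      (∫ s in (0 : ℝ)..a, (y - s) ^ β * g s) + ∫ s in a..y, (y - s) ^ β * g s :=
    (intervalIntegral.integral_add_adjacent_intervals
      (intervalIntegrable_sub_rpow_mul hβ0 hg le_rfl ha (by linarith))
      (intervalIntegrable_sub_rpow_mul hβ0 hg ha hay hy)).symm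
  have hint (y : ℝ) : IntervalIntegrable (fun s => (y - s) ^ β * g s) volume 0 a :=
    intervalIntegrable_sub_rpow_mul hβ0 hg le_rfl ha (by linarith)
  have hleft : (1 - θ) * (∫ s in (0 : ℝ)..a, (a - s) ^ β * g s) +
      θ * (∫ s in (0 : ℝ)..a, (b - s) ^ β * g s) - (∫ s in (0 : ℝ)..a, (x - s) ^ β * g s) =
      ∫ s in (0 : ℝ)..a,
        ((1 - θ) * (a - s) ^ β + θ * (b - s) ^ β - (x - s) ^ β) * g s := by
    rw [← intervalIntegral.integral_const_mul, ← intervalIntegral.integral_const_mul,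
      ← intervalIntegral.integral_add ((hint a).const_mul _) ((hint b).const_mul _),
      ← intervalIntegral.integral_sub
        (((hint a).const_mul _).add ((hint b).const_mul _)) (hint x)]
    congr 1
    ext s
    ring
  have h0 := abs_integral_weighted_le hβ0 hβ1 ha hax hxb hb hθ0 hθ1 hx hG
  have h1 := abs_integral_sub_rpow_mul_le hβ0 ha hb (hax.trans hxb) le_rfl hG
  have h2 := abs_integral_sub_rpow_mul_le hβ0 ha hb hax hxb hG
  rw [← hleft] at h0
  rw [hsplit b (hax.trans hxb) hb, hsplit x hax (hxb.trans hb)]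
  have h3 : |θ * ∫ s in a..b, (b - s) ^ β * g s| ≤ (b - a) ^ (β + 1) * G := by
    rw [abs_mul, abs_of_nonneg hθ0]
    exact (mul_le_of_le_one_left (abs_nonneg _) hθ1).trans h1
  rw [abs_le] at *
  constructor <;> linarith [h0.1, h0.2, h2.1, h2.2, h3.1, h3.2]

/-- Every point of `[0, 1]` lies in one of the `n + 1` cells of the uniform grid. -/
lemma exists_grid_cell (n : ℕ) {h x : ℝ} (hh : h = 1 / (n + 1)) (hx : x ∈ Set.Icc (0 : ℝ) 1) :
    ∃ i : ℕ, i ≤ n ∧ x ∈ Set.Icc ((i : ℝ) * h) (((i : ℝ) + 1) * h) := by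
  have hn : (0 : ℝ) < n + 1 := by positivity
  have hy0 : 0 ≤ x * (n + 1) := mul_nonneg hx.1 hn.le
  have key (i : ℕ) (h1 : (i : ℝ) ≤ x * (n + 1)) (h2 : x * (n + 1) ≤ i + 1) :
      x ∈ Set.Icc ((i : ℝ) * h) (((i : ℝ) + 1) * h) := by
    rw [hh, mul_one_div, mul_one_div]
    exact ⟨(div_le_iff₀ hn).2 h1, (le_div_iff₀ hn).2 h2⟩
  rcases le_total ⌊x * (n + 1)⌋₊ n with hi | hi
  · exact ⟨_, hi, key _ (Nat.floor_le hy0) (Nat.lt_floor_add_one _).le⟩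
  · exact ⟨n, le_rfl, key n ((Nat.cast_le.2 hi).trans (Nat.floor_le hy0))
      (mul_le_of_le_one_left hn.le hx.2)⟩

/-- order-`α` error of the piecewise power interpolation `Π_n f` for
`f = I^α g - I^α g(1) x^(α-1)` with `g ∈ C_0(0,1)`.  The interpolant is encoded by the
hypothesis `hP`: on each grid interval `[i h, (i+1) h]` (with `h = 1/(n+1)`), `P` equals the
unique combination `c x^(α-1) + d` matching `f` at the two endpoints.  The sup-norm of `g`
is encoded by an arbitrary uniform bound `G`. -/
theorem power_interpolation_error (α : ℝ) (hα1 : 1 < α) (hα2 : α ≤ 2) :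
    ∃ C : ℝ, 0 < C ∧ ∀ n : ℕ, 1 ≤ n → ∀ h : ℝ, h = 1 / (n + 1) →
      ∀ g : ℝ → ℝ, ContinuousOn g (Set.Icc 0 1) → g 0 = 0 →
      ∀ G : ℝ, (∀ s ∈ Set.Icc (0 : ℝ) 1, |g s| ≤ G) →
      ∀ f : ℝ → ℝ,
        (∀ x : ℝ, f x =
          (∫ s in (0 : ℝ)..x, (x - s) ^ (α - 1) / Real.Gamma α * g s) -
            (∫ s in (0 : ℝ)..1, (1 - s) ^ (α - 1) / Real.Gamma α * g s) * x ^ (α - 1)) →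
      ∀ P : ℝ → ℝ,
        (∀ i : ℕ, i ≤ n → ∀ x ∈ Set.Icc ((i : ℝ) * h) (((i : ℝ) + 1) * h),
          P x =
            (f (((i : ℝ) + 1) * h) - f ((i : ℝ) * h)) /
                ((((i : ℝ) + 1) * h) ^ (α - 1) - ((i : ℝ) * h) ^ (α - 1)) * x ^ (α - 1) +
              ((((i : ℝ) + 1) * h) ^ (α - 1) * f ((i : ℝ) * h) -
                  ((i : ℝ) * h) ^ (α - 1) * f (((i : ℝ) + 1) * h)) /
                ((((i : ℝ) + 1) * h) ^ (α - 1) - ((i : ℝ) * h) ^ (α - 1))) →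
      ∀ x ∈ Set.Icc (0 : ℝ) 1, |P x - f x| ≤ C * h ^ α * G := by
  have hΓ : 0 < Real.Gamma α := Real.Gamma_pos_of_pos (by linarith)
  refine ⟨3 / Real.Gamma α, by positivity, ?_⟩
  intro n _ h hh g hg _ G hG f hf P hP x hx
  obtain ⟨i, hin, hxi⟩ := exists_grid_cell n hh hx
  have hh0 : 0 < h := by rw [hh]; positivity
  rw [hP i hin x hxi]
  have hba : ((i : ℝ) + 1) * h - (i : ℝ) * h = h := by ring
  have ha : 0 ≤ (i : ℝ) * h := by positivity
  have hb : ((i : ℝ) + 1) * h ≤ 1 := by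
    rw [hh, mul_one_div]
    exact div_le_one_of_le₀ (by exact_mod_cast Nat.succ_le_succ hin) (by positivity)
  generalize (i : ℝ) * h = a at *
  generalize ((i : ℝ) + 1) * h = b at *
  have hβ : 0 < α - 1 := by linarith
  have hab : 0 < b ^ (α - 1) - a ^ (α - 1) :=
    sub_pos.2 (Real.rpow_lt_rpow ha (by linarith) hβ)
  have hax := Real.rpow_le_rpow ha hxi.1 hβ.le
  have hxb := Real.rpow_le_rpow hx.1 hxi.2 hβ.le
  obtain ⟨θ, hθ⟩ : ∃ θ, θ = (x ^ (α - 1) - a ^ (α - 1)) / (b ^ (α - 1) - a ^ (α - 1)) :=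
    ⟨_, rfl⟩
  have hθ0 : 0 ≤ θ := by rw [hθ]; exact div_nonneg (by linarith) hab.le
  have hθ1 : θ ≤ 1 := by rw [hθ]; exact div_le_one_of_le₀ (by linarith) hab.le
  have hxθ : x ^ (α - 1) = (1 - θ) * a ^ (α - 1) + θ * b ^ (α - 1) := by
    rw [hθ]; field_simp; ring
  have hmain := abs_weighted_fractional_integral_sub_le hβ (by linarith) ha hxi.1 hxi.2 hb
    hθ0 hθ1 hxθ hg hG
  rw [hba, sub_add_cancel] at hmain
  have hnormalise (y : ℝ) : ∫ s in (0 : ℝ)..y, (y - s) ^ (α - 1) / Real.Gamma α * g s =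
      (∫ s in (0 : ℝ)..y, (y - s) ^ (α - 1) * g s) / Real.Gamma α := by
    rw [← intervalIntegral.integral_div]
    congr 1
    ext s
    ring
  have hinterp : (f b - f a) / (b ^ (α - 1) - a ^ (α - 1)) * x ^ (α - 1) +
      (b ^ (α - 1) * f a - a ^ (α - 1) * f b) / (b ^ (α - 1) - a ^ (α - 1)) =
      (1 - θ) * f a + θ * f b := by
    rw [hθ]; field_simp; ring
  have herr : (1 - θ) * f a + θ * f b - f x =
      ((1 - θ) * (∫ s in (0 : ℝ)..a, (a - s) ^ (α - 1) * g s) +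
        θ * (∫ s in (0 : ℝ)..b, (b - s) ^ (α - 1) * g s) -
        ∫ s in (0 : ℝ)..x, (x - s) ^ (α - 1) * g s) / Real.Gamma α := by
    rw [hf a, hf b, hf x, hnormalise a, hnormalise b, hnormalise x, hxθ]
    ring
  rw [hinterp, herr, abs_div, abs_of_pos hΓ, div_le_iff₀ hΓ]
  calc _ ≤ 3 * (h ^ α * G) := hmain
    _ = 3 / Real.Gamma α * h ^ α * G * Real.Gamma α := by field_simp
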